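/- For integers 1 ≤ a ≤ b, let Q(a,b) be the triangle with vertices (−b(a+1), a), (b(a+1), a), and (0, −1). Then Q(a,b) is an IP-polygon whose three facets have local indices a, b, and b (so ℓ_{Q(a,b)} = lcm(a,b)); its normalized volume is Vol(Q(a,b)) = 2b(a+1)²; its number of boundary lattice points is |∂Q(a,b) ∩ ℤ²| = 2(a+1)(b+1); and Q(a,b) is an LDP-polygon if and only if gcd(a,b) = 1, in which case ℓ_{Q(a,b)} = ab. -/

import Mathlib

open Pointwise

/-- The embedding of the lattice `ℤ²` into `ℚ²`. -/
def toQ (p : ℤ × ℤ) : ℚ × ℚ := ((p.1 : ℚ), (p.2 : ℚ))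

/-- The pairing between the dual lattice `ℤ²` and `ℚ²`. -/
def pairQ (η : ℤ × ℤ) (x : ℚ × ℚ) : ℚ := (η.1 : ℚ) * x.1 + (η.2 : ℚ) * x.2

/-- A lattice polygon: the convex hull of finitely many lattice points,
with nonempty interior. -/
def IsLatticePolygon (Q : Set (ℚ × ℚ)) : Prop :=
  (∃ S : Finset (ℤ × ℤ), Q = convexHull ℚ (toQ '' (S : Set (ℤ × ℤ)))) ∧
    (interior Q).Nonempty

/-- An IP-polygon: a lattice polygon containing the origin in its interior. -/
def IsIPPolygon (Q : Set (ℚ × ℚ)) : Prop :=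
  IsLatticePolygon Q ∧ (0 : ℚ × ℚ) ∈ interior Q

/-- The vertices of a polygon are its extreme points. -/
def vertices (Q : Set (ℚ × ℚ)) : Set (ℚ × ℚ) := Set.extremePoints ℚ Q

/-- An LDP-polygon: an IP-polygon all of whose vertices are primitive lattice points. -/
def IsLDPPolygon (Q : Set (ℚ × ℚ)) : Prop :=
  IsIPPolygon Q ∧ ∀ v ∈ vertices Q, ∃ p : ℤ × ℤ, Int.gcd p.1 p.2 = 1 ∧ v = toQ p

/-- `IsFacetWith Q η l F` : `F` is a facet (edge) of `Q` with primitive outer normal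
`η` and local index `l`, i.e. `⟨η, x⟩ = l` on `F` and `⟨η, y⟩ ≤ l` on `Q`. -/
def IsFacetWith (Q : Set (ℚ × ℚ)) (η : ℤ × ℤ) (l : ℤ) (F : Set (ℚ × ℚ)) : Prop :=
  Int.gcd η.1 η.2 = 1 ∧ 0 < l ∧
  (∀ y ∈ Q, pairQ η y ≤ (l : ℚ)) ∧
  F = {x ∈ Q | pairQ η x = (l : ℚ)} ∧
  ∃ x ∈ F, ∃ y ∈ F, x ≠ y

/-- `F` is a facet of `Q`. -/
def IsFacet (Q F : Set (ℚ × ℚ)) : Prop := ∃ η l, IsFacetWith Q η l F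

/-- `HasMaxLocalIndex Q k` : the maximal local index `m_Q` of `Q` equals `k`. -/
def HasMaxLocalIndex (Q : Set (ℚ × ℚ)) (k : ℤ) : Prop :=
  (∃ F η, IsFacetWith Q η k F) ∧ ∀ F η l, IsFacetWith Q η l F → l ≤ k

/-- `HasIndex Q ℓ` : the index `ℓ_Q` of `Q` (the lcm of all local indices) equals `ℓ`. -/
def HasIndex (Q : Set (ℚ × ℚ)) (ℓ : ℤ) : Prop :=
  0 < ℓ ∧ (∀ F η l, IsFacetWith Q η l F → l ∣ ℓ) ∧
  ∀ m : ℤ, 0 < m → (∀ F η l, IsFacetWith Q η l F → l ∣ m) → ℓ ∣ m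

/-- The only lattice point in the interior of `(1/k)·Q` is the origin. -/
def NoIntLatticePts (Q : Set (ℚ × ℚ)) (k : ℤ) : Prop :=
  ∀ p : ℤ × ℤ, toQ p ∈ interior (((k : ℚ)⁻¹) • Q) → p = 0

/-- `HasOrder Q I` : the order `o_Q` of `Q` equals `I`. -/
def HasOrder (Q : Set (ℚ × ℚ)) (I : ℤ) : Prop :=
  1 ≤ I ∧ NoIntLatticePts Q I ∧ ∀ k : ℤ, 1 ≤ k → NoIntLatticePts Q k → I ≤ k

/-- The cone `pos(F) = ℝ≥0·F` spanned by `F` (inside `ℚ²`). -/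
def posCone (F : Set (ℚ × ℚ)) : Set (ℚ × ℚ) :=
  {y | ∃ t : ℚ, 0 ≤ t ∧ ∃ z ∈ F, y = t • z}

/-- The number of lattice points in a subset of `ℚ²`. -/
noncomputable def latticeCount (S : Set (ℚ × ℚ)) : ℕ :=
  {p : ℤ × ℤ | toQ p ∈ S}.ncard

/-- The normalised volume of `Q`: twice the Euclidean area of the corresponding
real region. -/
noncomputable def nVol (Q : Set (ℚ × ℚ)) : ℝ :=
  2 * (MeasureTheory.volume
    (closure ((fun x : ℚ × ℚ => ((x.1 : ℝ), (x.2 : ℝ))) '' Q))).toReal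

/-- Unimodular equivalence: `Q'` is the image of `Q` under an element of `GL(2,ℤ)`. -/
def UnimodEquiv (Q Q' : Set (ℚ × ℚ)) : Prop :=
  ∃ a b c d : ℤ, (a * d - b * c = 1 ∨ a * d - b * c = -1) ∧
    (fun x : ℚ × ℚ => ((a : ℚ) * x.1 + (b : ℚ) * x.2,
      (c : ℚ) * x.1 + (d : ℚ) * x.2)) '' Q = Q'

section Helpers

theorem Qab_closed {K : Type*} [Field K] [LinearOrder K] [TopologicalSpace K] [OrderTopology K]
    [IsTopologicalRing K] (a b : K) :
    IsClosed {z : K × K | z.2 ≤ a ∧ z.1 - b * z.2 ≤ b ∧ -z.1 - b * z.2 ≤ b} := by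
  have h1 : IsClosed {z : K × K | z.2 ≤ a} := isClosed_le (by fun_prop) (by fun_prop)
  have h2 : IsClosed {z : K × K | z.1 - b * z.2 ≤ b} := isClosed_le (by fun_prop) (by fun_prop)
  have h3 : IsClosed {z : K × K | -z.1 - b * z.2 ≤ b} := isClosed_le (by fun_prop) (by fun_prop)
  exact h1.inter (h2.inter h3)

theorem Qab_open {K : Type*} [Field K] [LinearOrder K] [TopologicalSpace K] [OrderTopology K]
    [IsTopologicalRing K] (a b : K) :
    IsOpen {z : K × K | z.2 < a ∧ z.1 - b * z.2 < b ∧ -z.1 - b * z.2 < b} := by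
  have h1 : IsOpen {z : K × K | z.2 < a} := isOpen_lt (by fun_prop) (by fun_prop)
  have h2 : IsOpen {z : K × K | z.1 - b * z.2 < b} := isOpen_lt (by fun_prop) (by fun_prop)
  have h3 : IsOpen {z : K × K | -z.1 - b * z.2 < b} := isOpen_lt (by fun_prop) (by fun_prop)
  exact h1.inter (h2.inter h3)

theorem Qab_mem (a b : ℤ) (ha : 1 ≤ a) (hab : a ≤ b) (z : ℚ × ℚ) :
    z ∈ convexHull ℚ {toQ (-(b * (a + 1)), a), toQ (b * (a + 1), a), toQ (0, -1)} ↔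
      z.2 ≤ a ∧ z.1 - b * z.2 ≤ b ∧ -z.1 - b * z.2 ≤ b := by
  have ha' : (1 : ℚ) ≤ a := by exact_mod_cast ha
  have hb' : (1 : ℚ) ≤ b := by exact_mod_cast ha.trans hab
  constructor
  · have hc : Convex ℚ {z : ℚ × ℚ | z.2 ≤ a ∧ z.1 - b * z.2 ≤ b ∧ -z.1 - b * z.2 ≤ b} := by
      rintro ⟨x, y⟩ ⟨h1, h2, h3⟩ ⟨x', y'⟩ ⟨h1', h2', h3'⟩ s t hs ht hst
      obtain rfl : t = 1 - s := by linarith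
      simp only [Set.mem_ofPred_eq, Prod.snd_add, Prod.fst_add, Prod.smul_fst, Prod.smul_snd,
        smul_eq_mul] at *
      refine ⟨?_, ?_, ?_⟩ <;> nlinarith
    refine fun hz => convexHull_min ?_ hc hz
    rintro w (rfl | rfl | rfl) <;> simp only [toQ, Set.mem_ofPred_eq] <;> push_cast <;>
      refine ⟨?_, ?_, ?_⟩ <;> nlinarith
  · rintro ⟨h1, h2, h3⟩
    have hc := convex_convexHull ℚ ({toQ (-(b * (a + 1)), a), toQ (b * (a + 1), a), toQ (0, -1)} :
      Set (ℚ × ℚ))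
    have hs := subset_convexHull ℚ ({toQ (-(b * (a + 1)), a), toQ (b * (a + 1), a), toQ (0, -1)} :
      Set (ℚ × ℚ))
    have hD : (0 : ℚ) < 2 * b * (a + 1) := by positivity
    have hA : (0 : ℚ) < a + 1 := by positivity
    have key := hc.sum_mem (t := Finset.univ)
      (w := ![(b - z.1 + b * z.2) / (2 * b * (a + 1)), (b + z.1 + b * z.2) / (2 * b * (a + 1)),
        (a - z.2) / (a + 1)])
      (z := ![toQ (-(b * (a + 1)), a), toQ (b * (a + 1), a), toQ (0, -1)])
      (by
        intro i _
        fin_cases i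
        · exact div_nonneg (by linarith) hD.le
        · exact div_nonneg (by linarith) hD.le
        · exact div_nonneg (by linarith) hA.le)
      (by
        simp [Fin.sum_univ_three]
        field_simp
        ring)
      (by
        intro i _
        fin_cases i <;> apply hs <;> simp)
    convert key using 1
    simp only [Fin.sum_univ_three, toQ]
    ext
    · simp
      field_simp
      ring
    · simp
      field_simp
      ring

theorem Qab_interior (a b : ℤ) (ha : 1 ≤ a) (hab : a ≤ b) (Q : Set (ℚ × ℚ))
    (hQ : ∀ z : ℚ × ℚ, z ∈ Q ↔ z.2 ≤ a ∧ z.1 - b * z.2 ≤ b ∧ -z.1 - b * z.2 ≤ b) (z : ℚ × ℚ) :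
    z ∈ interior Q ↔ z.2 < a ∧ z.1 - b * z.2 < b ∧ -z.1 - b * z.2 < b := by
  constructor
  · intro hz
    have key : ∀ d : ℚ × ℚ, ∃ t : ℚ, 0 < t ∧ z + t • d ∈ Q := by
      intro d
      have hcont : Filter.Tendsto (fun t : ℚ => z + t • d) (nhds 0) (nhds z) := by
        have : Continuous (fun t : ℚ => z + t • d) := by fun_prop
        simpa using this.tendsto 0
      have h1 := hcont.eventually (mem_interior_iff_mem_nhds.1 hz)
      have h2 : ∀ᶠ t : ℚ in nhdsWithin 0 (Set.Ioi 0), z + t • d ∈ Q := h1.filter_mono inf_le_left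
      obtain ⟨t, ht, ht'⟩ := (h2.and self_mem_nhdsWithin).exists
      exact ⟨t, ht', ht⟩
    refine ⟨?_, ?_, ?_⟩
    · obtain ⟨t, ht, h⟩ := key (0, 1)
      have := ((hQ _).1 h).1
      simp at this
      linarith
    · obtain ⟨t, ht, h⟩ := key (1, 0)
      have := ((hQ _).1 h).2.1
      simp at this
      linarith
    · obtain ⟨t, ht, h⟩ := key (-1, 0)
      have := ((hQ _).1 h).2.2
      simp at this
      linarith
  · intro hz
    rw [mem_interior]
    refine ⟨{z | z.2 < a ∧ z.1 - b * z.2 < b ∧ -z.1 - b * z.2 < b}, ?_, ?_, hz⟩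
    · rintro w ⟨h1, h2, h3⟩
      exact (hQ w).2 ⟨h1.le, h2.le, h3.le⟩
    · exact Qab_open _ _

theorem Qab_frontier (a b : ℤ) (ha : 1 ≤ a) (hab : a ≤ b) (Q : Set (ℚ × ℚ))
    (hQ : ∀ z : ℚ × ℚ, z ∈ Q ↔ z.2 ≤ a ∧ z.1 - b * z.2 ≤ b ∧ -z.1 - b * z.2 ≤ b) (z : ℚ × ℚ) :
    z ∈ frontier Q ↔ (z.2 ≤ a ∧ z.1 - b * z.2 ≤ b ∧ -z.1 - b * z.2 ≤ b) ∧
      ¬ (z.2 < a ∧ z.1 - b * z.2 < b ∧ -z.1 - b * z.2 < b) := by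
  have hcl : IsClosed Q := by
    have : Q = {z : ℚ × ℚ | z.2 ≤ a ∧ z.1 - b * z.2 ≤ b ∧ -z.1 - b * z.2 ≤ b} := by
      ext z; exact hQ z
    rw [this]
    exact Qab_closed _ _
  rw [hcl.frontier_eq, Set.mem_sdiff, hQ, Qab_interior a b ha hab Q hQ]

theorem Qab_count (a b : ℤ) (ha : 1 ≤ a) (hab : a ≤ b) (Q : Set (ℚ × ℚ))
    (hQ : ∀ z : ℚ × ℚ, z ∈ Q ↔ z.2 ≤ a ∧ z.1 - b * z.2 ≤ b ∧ -z.1 - b * z.2 ≤ b) :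
    (latticeCount (frontier Q) : ℤ) = 2 * (a + 1) * (b + 1) := by
  have hb : 1 ≤ b := ha.trans hab
  let S₁ : Finset (ℤ × ℤ) := (Finset.Icc (-(b * (a + 1))) (b * (a + 1))).image fun x => (x, a)
  let S₂ : Finset (ℤ × ℤ) := (Finset.Icc (-1) (a - 1)).image fun y => (b * (1 + y), y)
  let S₃ : Finset (ℤ × ℤ) := (Finset.Icc 0 (a - 1)).image fun y => (-(b * (1 + y)), y)
  have hset : {p : ℤ × ℤ | toQ p ∈ frontier Q} = ((S₁ ∪ (S₂ ∪ S₃) : Finset (ℤ × ℤ)) : Set (ℤ × ℤ)) := by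
    ext ⟨x, y⟩
    rw [Set.mem_ofPred_eq, Qab_frontier a b ha hab Q hQ]
    simp only [toQ]
    have e : ((((y : ℚ) ≤ a ∧ (x : ℚ) - b * y ≤ b ∧ -(x : ℚ) - b * y ≤ b) ∧
      ¬ ((y : ℚ) < a ∧ (x : ℚ) - b * y < b ∧ -(x : ℚ) - b * y < b)) ↔
      ((y ≤ a ∧ x - b * y ≤ b ∧ -x - b * y ≤ b) ∧
      ¬ (y < a ∧ x - b * y < b ∧ -x - b * y < b))) := by norm_cast
    rw [e]
    simp only [S₁, S₂, S₃, Finset.coe_union, Finset.coe_image, Set.mem_union, Set.mem_image,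
      Finset.coe_Icc, Set.mem_Icc, Prod.mk.injEq]
    constructor
    · rintro ⟨⟨h1, h2, h3⟩, h⟩
      have hy : -1 ≤ y := by nlinarith
      rcases h1.eq_or_lt with h1 | h1
      · subst h1
        left
        exact ⟨x, ⟨by linarith, by linarith⟩, rfl, rfl⟩
      rcases h2.eq_or_lt with h2 | h2
      · right; left
        exact ⟨y, ⟨hy, by omega⟩, by linarith, rfl⟩
      rcases h3.eq_or_lt with h3 | h3
      · right; right
        refine ⟨y, ⟨?_, by omega⟩, by linarith, rfl⟩
        nlinarith
      · exact absurd ⟨h1, h2, h3⟩ h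
    · rintro (⟨x', ⟨h1, h2⟩, rfl, rfl⟩ | ⟨y', ⟨h1, h2⟩, rfl, rfl⟩ | ⟨y', ⟨h1, h2⟩, rfl, rfl⟩)
      · exact ⟨⟨le_rfl, by linarith, by linarith⟩, fun h => by linarith [h.1]⟩
      · exact ⟨⟨by linarith, by linarith, by nlinarith⟩, fun h => by linarith [h.2.1]⟩
      · exact ⟨⟨by linarith, by nlinarith, by linarith⟩, fun h => by linarith [h.2.2]⟩
  have hd : Disjoint S₂ S₃ := by
    rw [Finset.disjoint_left]
    rintro ⟨x, y⟩ h h'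
    simp only [S₂, S₃, Finset.mem_image, Finset.mem_Icc, Prod.mk.injEq] at h h'
    obtain ⟨u, ⟨h1, h2⟩, h3, rfl⟩ := h
    obtain ⟨v, ⟨h1', h2'⟩, h3', rfl⟩ := h'
    nlinarith
  have hd' : Disjoint S₁ (S₂ ∪ S₃) := by
    rw [Finset.disjoint_left]
    rintro ⟨x, y⟩ h h'
    simp only [S₁, S₂, S₃, Finset.mem_union, Finset.mem_image, Finset.mem_Icc, Prod.mk.injEq] at h h'
    omega
  have c1 : (S₁.card : ℤ) = 2 * (b * (a + 1)) + 1 := by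
    rw [Finset.card_image_of_injective _ (fun x y h => (Prod.mk.inj h).1), Int.card_Icc,
      Int.toNat_of_nonneg] <;> nlinarith
  have c2 : (S₂.card : ℤ) = a + 1 := by
    rw [Finset.card_image_of_injective _ (fun x y h => (Prod.mk.inj h).2), Int.card_Icc,
      Int.toNat_of_nonneg] <;> linarith
  have c3 : (S₃.card : ℤ) = a := by
    rw [Finset.card_image_of_injective _ (fun x y h => (Prod.mk.inj h).2), Int.card_Icc,
      Int.toNat_of_nonneg] <;> linarith
  unfold latticeCount
  rw [hset, Set.ncard_coe_finset, Finset.card_union_of_disjoint hd', Finset.card_union_of_disjoint hd]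
  push_cast
  rw [c1, c2, c3]
  ring

theorem Qab_facet (a b : ℤ) (ha : 1 ≤ a) (hab : a ≤ b) (Q : Set (ℚ × ℚ))
    (hQ : ∀ z : ℚ × ℚ, z ∈ Q ↔ z.2 ≤ a ∧ z.1 - b * z.2 ≤ b ∧ -z.1 - b * z.2 ≤ b)
    (F : Set (ℚ × ℚ)) (η : ℤ × ℤ) (l : ℤ) (h : IsFacetWith Q η l F) :
    (η = (0, 1) ∧ l = a) ∨ (η = (1, -b) ∧ l = b) ∨ (η = (-1, -b) ∧ l = b) := by
  have hb : 1 ≤ b := ha.trans hab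
  have ha' : (1 : ℚ) ≤ a := by exact_mod_cast ha
  have hb' : (1 : ℚ) ≤ b := by exact_mod_cast hb
  obtain ⟨p, q⟩ := η
  obtain ⟨hg, hl, hle, rfl, x, ⟨hx, hxl⟩, y, ⟨hy, hyl⟩, hxy⟩ := h
  simp only [pairQ] at *
  have v1 : -(p * (b * (a + 1))) + q * a ≤ l := by
    have := hle (-(b * (a + 1)), a) ((hQ _).2 ⟨le_rfl, by nlinarith, by nlinarith⟩)
    have h : ((-(p * (b * (a + 1))) + q * a : ℤ) : ℚ) ≤ l := by
      push_cast; linarith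
    exact_mod_cast h
  have v2 : (p * (b * (a + 1))) + q * a ≤ l := by
    have := hle ((b * (a + 1)), a) ((hQ _).2 ⟨le_rfl, by nlinarith, by nlinarith⟩)
    have h : (((p * (b * (a + 1))) + q * a : ℤ) : ℚ) ≤ l := by
      push_cast; linarith
    exact_mod_cast h
  have v3 : -q ≤ l := by
    have := hle (0, -1) ((hQ _).2 ⟨by simp; linarith, by simp, by simp⟩)
    have h : ((-q : ℤ) : ℚ) ≤ l := by
      push_cast; linarith
    exact_mod_cast h
  -- strictness at a vertex forces the barycentric coordinate to vanish
  have key : ∀ z ∈ Q, (p : ℚ) * z.1 + q * z.2 = l →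
      (-(p * (b * (a + 1))) + q * a < l → z.1 - b * z.2 = b) ∧
      ((p * (b * (a + 1))) + q * a < l → -z.1 - b * z.2 = b) ∧ (-q < l → z.2 = a) := by
    intro z hz hzl
    obtain ⟨z1, z2, z3⟩ := (hQ z).1 hz
    have w1 : (0 : ℚ) ≤ l - (-(p * (b * (a + 1))) + q * a) := by
      rw [sub_nonneg]; exact_mod_cast v1
    have w2 : (0 : ℚ) ≤ l - ((p * (b * (a + 1))) + q * a) := by
      rw [sub_nonneg]; exact_mod_cast v2
    have w3 : (0 : ℚ) ≤ l + q := by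
      have : (0 : ℤ) ≤ l + q := by linarith
      exact_mod_cast this
    have z1' : 0 ≤ a - z.2 := by linarith
    have z2' : 0 ≤ b - (z.1 - b * z.2) := by linarith
    have z3' : 0 ≤ b - (-z.1 - b * z.2) := by linarith
    have id : (b - (z.1 - b * z.2)) * (l - (-(p * (b * (a + 1))) + q * a)) +
      (b - (-z.1 - b * z.2)) * (l - ((p * (b * (a + 1))) + q * a)) +
      2 * b * (a - z.2) * (l + q) = 0 := by
      rw [← hzl]; ring
    have m1 := mul_nonneg z2' w1
    have m2 := mul_nonneg z3' w2
    have m3 : 0 ≤ 2 * b * (a - z.2) * (l + q) := by positivity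
    refine ⟨fun h => ?_, fun h => ?_, fun h => ?_⟩
    · have h' : (0 : ℚ) < l - (-(p * (b * (a + 1))) + q * a) := by
        rw [sub_pos]; exact_mod_cast h
      have : (b - (z.1 - b * z.2)) * (l - (-(p * (b * (a + 1))) + q * a)) = 0 := by linarith
      rcases mul_eq_zero.1 this with h | h <;> linarith
    · have h' : (0 : ℚ) < l - ((p * (b * (a + 1))) + q * a) := by
        rw [sub_pos]; exact_mod_cast h
      have : (b - (-z.1 - b * z.2)) * (l - ((p * (b * (a + 1))) + q * a)) = 0 := by linarith
      rcases mul_eq_zero.1 this with h | h <;> linarith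
    · have h' : (0 : ℚ) < l + q := by
        have : (0 : ℤ) < l + q := by linarith
        exact_mod_cast this
      have : 2 * b * (a - z.2) * (l + q) = 0 := by linarith
      rcases mul_eq_zero.1 this with h | h
      · rcases mul_eq_zero.1 h with h | h <;> linarith
      · linarith
  obtain ⟨kx1, kx2, kx3⟩ := key x hx hxl
  obtain ⟨ky1, ky2, ky3⟩ := key y hy hyl
  have hbne : (b : ℚ) ≠ 0 := by linarith
  rcases v1.eq_or_lt with e1 | e1
  · rcases v2.eq_or_lt with e2 | e2
    · left
      have hp : p = 0 := by
        have : p * (b * (a + 1)) = 0 := by linarith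
        rcases mul_eq_zero.1 this with h | h
        · exact h
        · nlinarith
      subst hp
      simp at hg
      have hq : q = 1 := by
        have : 0 < q * a := by linarith
        have : 0 < q := pos_of_mul_pos_left this (by linarith)
        omega
      subst hq
      exact ⟨rfl, by linarith⟩
    · rcases v3.eq_or_lt with e3 | e3
      · right; right
        have hq : q = p * b := by
          have : (a + 1) * (q - p * b) = 0 := by linarith
          rcases mul_eq_zero.1 this with h | h <;> linarith
        subst hq
        have hp : p.natAbs = 1 := by simpa using hg
        have : p < 0 := by nlinarith
        obtain rfl : p = -1 := by omega
        exact ⟨by simp, by linarith⟩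
      · exfalso
        apply hxy
        have := kx2 e2; have := kx3 e3; have := ky2 e2; have := ky3 e3
        have h2 : x.2 = y.2 := by linarith
        refine Prod.ext ?_ h2
        have h3 : (b : ℚ) * x.2 = b * y.2 := by rw [h2]
        linarith
  · have A := kx1 e1
    have A' := ky1 e1
    rcases v2.eq_or_lt with e2 | e2
    · rcases v3.eq_or_lt with e3 | e3
      · right; left
        have hq : q = -p * b := by
          have : (a + 1) * (q + p * b) = 0 := by linarith
          rcases mul_eq_zero.1 this with h | h <;> linarith
        subst hq
        have hp : p.natAbs = 1 := by simpa using hg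
        have : 0 < p := by nlinarith
        obtain rfl : p = 1 := by omega
        exact ⟨by simp, by linarith⟩
      · exfalso
        apply hxy
        have := kx3 e3; have := ky3 e3
        have h2 : x.2 = y.2 := by linarith
        refine Prod.ext ?_ h2
        have h3 : (b : ℚ) * x.2 = b * y.2 := by rw [h2]
        linarith
    · exfalso
      apply hxy
      have := kx2 e2; have := ky2 e2
      have h2 : x.2 = y.2 := by
        apply mul_left_cancel₀ hbne
        linarith
      refine Prod.ext ?_ h2
      linarith

theorem Qab_vol (a b : ℤ) (ha : 1 ≤ a) (hab : a ≤ b) (Q : Set (ℚ × ℚ))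
    (hQ : ∀ z : ℚ × ℚ, z ∈ Q ↔ z.2 ≤ a ∧ z.1 - b * z.2 ≤ b ∧ -z.1 - b * z.2 ≤ b) :
    nVol Q = 2 * (b : ℝ) * ((a : ℝ) + 1) ^ 2 := by
  have ha' : (1 : ℝ) ≤ a := by exact_mod_cast ha
  have hb' : (1 : ℝ) ≤ b := by exact_mod_cast ha.trans hab
  set T : Set (ℝ × ℝ) := {z | z.2 ≤ a ∧ z.1 - b * z.2 ≤ b ∧ -z.1 - b * z.2 ≤ b} with hT
  have hTc : IsClosed T :=
    Qab_closed _ _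
  have hcl : closure ((fun x : ℚ × ℚ => ((x.1 : ℝ), (x.2 : ℝ))) '' Q) = T := by
    apply subset_antisymm
    · apply closure_minimal _ hTc
      rintro _ ⟨z, hz, rfl⟩
      obtain ⟨h1, h2, h3⟩ := (hQ z).1 hz
      refine ⟨?_, ?_, ?_⟩
      · change (z.2 : ℝ) ≤ a
        exact_mod_cast h1
      · change (z.1 : ℝ) - b * z.2 ≤ b
        exact_mod_cast h2
      · change -(z.1 : ℝ) - b * z.2 ≤ b
        exact_mod_cast h3
    · set U : Set (ℝ × ℝ) := {z | z.2 < a ∧ z.1 - b * z.2 < b ∧ -z.1 - b * z.2 < b} with hU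
      have hUo : IsOpen U := Qab_open _ _
      have hTU : T ⊆ closure U := by
        rintro z ⟨h1, h2, h3⟩
        have hcont : Filter.Tendsto (fun t : ℝ => (1 - t) • z) (nhdsWithin 0 (Set.Ioo 0 1))
            (nhds z) := by
          have : Continuous (fun t : ℝ => (1 - t) • z) := by fun_prop
          have := this.tendsto 0
          simp only [sub_zero, one_smul] at this
          exact this.mono_left inf_le_left
        have : (nhdsWithin (0 : ℝ) (Set.Ioo 0 1)).NeBot := by
          rw [← mem_closure_iff_nhdsWithin_neBot, closure_Ioo (by norm_num)]
          simp
        refine mem_closure_of_tendsto hcont ?_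
        filter_upwards [self_mem_nhdsWithin] with t ht
        obtain ⟨t0, t1⟩ := ht
        simp only [hU, Set.mem_ofPred_eq, Prod.smul_fst, Prod.smul_snd, smul_eq_mul]
        refine ⟨?_, ?_, ?_⟩ <;> nlinarith
      have hd : DenseRange (Prod.map (fun q : ℚ => (q : ℝ)) (fun q : ℚ => (q : ℝ))) :=
        Rat.denseRange_cast.prodMap Rat.denseRange_cast
      refine hTU.trans (closure_minimal ((hd.open_subset_closure_inter hUo).trans
        (closure_mono ?_)) isClosed_closure)
      rintro _ ⟨⟨h1, h2, h3⟩, z, rfl⟩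
      change (z.2 : ℝ) < a at h1
      change (z.1 : ℝ) - b * z.2 < b at h2
      change -(z.1 : ℝ) - b * z.2 < b at h3
      refine ⟨z, (hQ z).2 ⟨?_, ?_, ?_⟩, rfl⟩
      · exact_mod_cast h1.le
      · exact_mod_cast h2.le
      · exact_mod_cast h3.le
  have hvol : MeasureTheory.volume T = ENNReal.ofReal (b * (a + 1) ^ 2) := by
    rw [MeasureTheory.Measure.volume_eq_prod,
      MeasureTheory.Measure.prod_apply_symm hTc.measurableSet]
    have hsec : ∀ y : ℝ, MeasureTheory.volume ((fun x : ℝ => (x, y)) ⁻¹' T) =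
        (Set.Icc (-1 : ℝ) a).indicator (fun y => ENNReal.ofReal (2 * b * (1 + y))) y := by
      intro y
      by_cases hy : y ≤ a
      · have : (fun x : ℝ => (x, y)) ⁻¹' T = Set.Icc (-(b * (1 + y))) (b * (1 + y)) := by
          ext x
          simp only [hT, Set.mem_preimage, Set.mem_ofPred_eq, Set.mem_Icc]
          constructor
          · rintro ⟨h1, h2, h3⟩
            constructor <;> linarith
          · rintro ⟨h1, h2⟩
            refine ⟨hy, ?_, ?_⟩ <;> linarith
        rw [this, Real.volume_Icc]
        by_cases hy' : -1 ≤ y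
        · rw [Set.indicator_of_mem (Set.mem_Icc.2 ⟨hy', hy⟩)]
          congr 1
          ring
        · rw [Set.indicator_of_notMem (fun h => hy' h.1)]
          rw [ENNReal.ofReal_eq_zero]
          nlinarith
      · rw [Set.indicator_of_notMem (fun h => hy h.2)]
        have : (fun x : ℝ => (x, y)) ⁻¹' T = ∅ := by
          ext x
          simp only [hT, Set.mem_preimage, Set.mem_ofPred_eq, Set.mem_empty_iff_false, iff_false]
          exact fun h => hy h.1
        rw [this, MeasureTheory.measure_empty]
    simp_rw [hsec]
    rw [MeasureTheory.lintegral_indicator measurableSet_Icc,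
      ← MeasureTheory.ofReal_integral_eq_lintegral_ofReal]
    · congr 1
      rw [MeasureTheory.integral_Icc_eq_integral_Ioc, ← intervalIntegral.integral_of_le (by linarith)]
      rw [intervalIntegral.integral_const_mul, intervalIntegral.integral_add (by simp) (by simp)]
      simp
      ring
    · exact (by fun_prop : Continuous fun y : ℝ => 2 * (b : ℝ) * (1 + y)).continuousOn.integrableOn_Icc
    · filter_upwards [MeasureTheory.ae_restrict_mem measurableSet_Icc] with y hy
      have : 0 ≤ 1 + y := by linarith [hy.1]
      simp only [Pi.zero_apply]
      positivity
  unfold nVol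
  rw [hcl, hvol, ENNReal.toReal_ofReal (by positivity)]
  ring

theorem Qab_ext (a b : ℤ) (ha : 1 ≤ a) (hab : a ≤ b) (Q : Set (ℚ × ℚ))
    (hQ : ∀ z : ℚ × ℚ, z ∈ Q ↔ z.2 ≤ a ∧ z.1 - b * z.2 ≤ b ∧ -z.1 - b * z.2 ≤ b) :
    toQ (b * (a + 1), a) ∈ vertices Q := by
  have ha' : (1 : ℚ) ≤ a := by exact_mod_cast ha
  have hb' : (1 : ℚ) ≤ b := by exact_mod_cast ha.trans hab
  unfold vertices
  rw [mem_extremePoints_iff_left]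
  refine ⟨(hQ _).2 ?_, ?_⟩
  · simp only [toQ]; push_cast
    refine ⟨le_rfl, ?_, ?_⟩ <;> nlinarith
  · rintro ⟨x, y⟩ hx ⟨x', y'⟩ hx' ⟨s, t, hs, ht, hst, h⟩
    obtain ⟨h1, h2, -⟩ := (hQ _).1 hx
    obtain ⟨h1', h2', -⟩ := (hQ _).1 hx'
    simp only [toQ, Prod.ext_iff, Prod.snd_add, Prod.fst_add, Prod.smul_fst, Prod.smul_snd,
        smul_eq_mul] at *
    push_cast at *
    obtain ⟨e1, e2⟩ := h
    have hy : y = a := by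
      have : s * (a - y) + t * (a - y') = 0 := by
        linear_combination (-1 : ℚ) * e2 + a * hst
      have p1 := mul_nonneg hs.le (sub_nonneg.2 h1)
      have p2 := mul_nonneg ht.le (sub_nonneg.2 h1')
      have : s * (a - y) = 0 := by linarith
      rcases mul_eq_zero.1 this with h | h <;> linarith
    refine ⟨?_, hy⟩
    have : s * (b - (x - b * y)) + t * (b - (x' - b * y')) = 0 := by
      linear_combination (-1 : ℚ) * e1 + b * e2 + b * hst
    have p1 := mul_nonneg hs.le (sub_nonneg.2 h2)
    have p2 := mul_nonneg ht.le (sub_nonneg.2 h2')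
    have : s * (b - (x - b * y)) = 0 := by linarith
    rcases mul_eq_zero.1 this with h | h
    · linarith
    · subst hy; linarith

theorem Qab_gcd (a b : ℤ) : Int.gcd (b * (a + 1)) a = 1 ↔ Int.gcd a b = 1 := by
  rw [← Int.isCoprime_iff_gcd_eq_one, ← Int.isCoprime_iff_gcd_eq_one, IsCoprime.mul_left_iff]
  constructor
  · exact fun h => h.1.symm
  · exact fun h => ⟨h.symm, ⟨1, -1, by ring⟩⟩

end Helpers

/-- Properties of the triangle `Q(a,b)` with vertices `(−b(a+1), a)`, `(b(a+1), a)`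
and `(0, −1)`, for `1 ≤ a ≤ b`: it is an IP-polygon, its three facets have local
indices `a`, `b`, `b`, its index is `lcm(a,b)`, its normalised volume is
`2b(a+1)²`, it has `2(a+1)(b+1)` boundary lattice points, and it is an LDP-polygon
iff `gcd(a,b) = 1`, in which case its index is `ab`. -/
theorem triangle_Qab_properties
    (a b : ℤ) (ha : 1 ≤ a) (hab : a ≤ b)
    (Q : Set (ℚ × ℚ))
    (hQ : Q = convexHull ℚ
      {toQ (-(b * (a + 1)), a), toQ (b * (a + 1), a), toQ (0, -1)}) :
    IsIPPolygon Q ∧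
    (∃ F₁ F₂ F₃ : Set (ℚ × ℚ), ∃ η₁ η₂ η₃ : ℤ × ℤ,
      IsFacetWith Q η₁ a F₁ ∧ IsFacetWith Q η₂ b F₂ ∧ IsFacetWith Q η₃ b F₃ ∧
      F₁ ≠ F₂ ∧ F₁ ≠ F₃ ∧ F₂ ≠ F₃ ∧
      (∀ F : Set (ℚ × ℚ), IsFacet Q F → F = F₁ ∨ F = F₂ ∨ F = F₃)) ∧
    HasIndex Q (lcm a b) ∧
    nVol Q = 2 * (b : ℝ) * ((a : ℝ) + 1) ^ 2 ∧
    (latticeCount (frontier Q) : ℤ) = 2 * (a + 1) * (b + 1) ∧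
    (IsLDPPolygon Q ↔ Int.gcd a b = 1) ∧
    (Int.gcd a b = 1 → HasIndex Q (a * b)) := by
  have hb : 1 ≤ b := ha.trans hab
  have ha' : (1 : ℚ) ≤ a := by exact_mod_cast ha
  have hb' : (1 : ℚ) ≤ b := by exact_mod_cast hb
  have hm : ∀ z : ℚ × ℚ, z ∈ Q ↔ z.2 ≤ a ∧ z.1 - b * z.2 ≤ b ∧ -z.1 - b * z.2 ≤ b := by
    intro z; rw [hQ]; exact Qab_mem a b ha hab z
  have h0 : (0 : ℚ × ℚ) ∈ interior Q := by
    rw [Qab_interior a b ha hab Q hm]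
    simp only [Prod.snd_zero, Prod.fst_zero]
    refine ⟨?_, ?_, ?_⟩ <;> linarith
  have hIP : IsIPPolygon Q := by
    refine ⟨⟨⟨{(-(b * (a + 1)), a), (b * (a + 1), a), (0, -1)}, ?_⟩, ⟨0, h0⟩⟩, h0⟩
    rw [hQ]
    simp [Set.image_insert_eq]
  have m1 : ((-(b * (a + 1)), a) : ℚ × ℚ) ∈ Q := (hm _).2 ⟨le_rfl, by nlinarith, by nlinarith⟩
  have m2 : (((b * (a + 1)), a) : ℚ × ℚ) ∈ Q := (hm _).2 ⟨le_rfl, by nlinarith, by nlinarith⟩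
  have m3 : ((0, -1) : ℚ × ℚ) ∈ Q := (hm _).2 ⟨by simp; linarith, by simp, by simp⟩
  have hB : (0 : ℚ) < b * (a + 1) := by positivity
  have f1 : IsFacetWith Q (0, 1) a {x ∈ Q | pairQ (0, 1) x = (a : ℚ)} := by
    refine ⟨by simp, by linarith, ?_, rfl, _, ⟨m1, by simp [pairQ]⟩, _, ⟨m2, by simp [pairQ]⟩, ?_⟩
    · intro y hy
      have := ((hm y).1 hy).1
      simpa [pairQ] using this
    · intro h
      have := (Prod.mk.inj h).1
      linarith
  have f2 : IsFacetWith Q (1, -b) b {x ∈ Q | pairQ (1, -b) x = (b : ℚ)} := by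
    refine ⟨by simp, by linarith, ?_, rfl, _, ⟨m2, by simp [pairQ]; ring⟩, _,
      ⟨m3, by simp [pairQ]⟩, ?_⟩
    · intro y hy
      have := ((hm y).1 hy).2.1
      simp [pairQ]; linarith
    · intro h
      have := (Prod.mk.inj h).1
      linarith
  have f3 : IsFacetWith Q (-1, -b) b {x ∈ Q | pairQ (-1, -b) x = (b : ℚ)} := by
    refine ⟨by simp, by linarith, ?_, rfl, _, ⟨m1, by simp [pairQ]; ring⟩, _,
      ⟨m3, by simp [pairQ]⟩, ?_⟩
    · intro y hy
      have := ((hm y).1 hy).2.2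
      simp [pairQ]; linarith
    · intro h
      have := (Prod.mk.inj h).1
      linarith
  have hfac := Qab_facet a b ha hab Q hm
  have hidx : HasIndex Q (lcm a b) := by
    refine ⟨?_, ?_, ?_⟩
    · have h1 : lcm a b ≠ 0 := by
        rw [Ne, lcm_eq_zero_iff]; omega
      have h2 : (0 : ℤ) ≤ lcm a b := by
        rw [← Int.coe_lcm]; positivity
      omega
    · intro F η l h
      rcases hfac F η l h with ⟨-, rfl⟩ | ⟨-, rfl⟩ | ⟨-, rfl⟩
      · exact dvd_lcm_left _ _
      · exact dvd_lcm_right _ _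
      · exact dvd_lcm_right _ _
    · intro m _ h
      exact lcm_dvd (h _ _ _ f1) (h _ _ _ f2)
  refine ⟨hIP, ⟨_, _, _, _, _, _, f1, f2, f3, ?_, ?_, ?_, ?_⟩, hidx, Qab_vol a b ha hab Q hm,
    Qab_count a b ha hab Q hm, ⟨?_, ?_⟩, ?_⟩
  · intro h
    have h1 : ((0, -1) : ℚ × ℚ) ∈ {x ∈ Q | pairQ (0, 1) x = (a : ℚ)} := by
      rw [h]; exact ⟨m3, by simp [pairQ]⟩
    have := h1.2
    simp [pairQ] at this
    linarith
  · intro h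
    have h1 : ((0, -1) : ℚ × ℚ) ∈ {x ∈ Q | pairQ (0, 1) x = (a : ℚ)} := by
      rw [h]; exact ⟨m3, by simp [pairQ]⟩
    have := h1.2
    simp [pairQ] at this
    linarith
  · intro h
    have h1 : (((b * (a + 1)), a) : ℚ × ℚ) ∈ {x ∈ Q | pairQ (-1, -b) x = (b : ℚ)} := by
      rw [← h]; exact ⟨m2, by simp [pairQ]; ring⟩
    have := h1.2
    simp [pairQ] at this
    nlinarith
  · rintro F ⟨η, l, h⟩
    have hF := h.2.2.2.1
    rcases hfac F η l h with ⟨rfl, rfl⟩ | ⟨rfl, rfl⟩ | ⟨rfl, rfl⟩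
    · exact Or.inl hF
    · exact Or.inr (Or.inl hF)
    · exact Or.inr (Or.inr hF)
  · rintro ⟨-, h⟩
    obtain ⟨p, hp, he⟩ := h _ (Qab_ext a b ha hab Q hm)
    simp only [toQ, Prod.mk.injEq, Int.cast_inj] at he
    rw [← he.1, ← he.2] at hp
    exact (Qab_gcd a b).1 hp
  · intro hg
    refine ⟨hIP, fun v hv => ?_⟩
    unfold vertices at hv
    rw [hQ] at hv
    rcases extremePoints_convexHull_subset hv with rfl | rfl | rfl
    · exact ⟨_, by simpa using (Qab_gcd a b).2 hg, rfl⟩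
    · exact ⟨_, (Qab_gcd a b).2 hg, rfl⟩
    · exact ⟨_, by simp, rfl⟩
  · intro hg
    have : lcm a b = a * b := by
      rw [← Int.coe_lcm]
      have h := Int.gcd_mul_lcm a b
      rw [hg, one_mul] at h
      rw [h, ← Int.natAbs_mul, Int.natAbs_of_nonneg (by positivity)]
    rw [← this]
    exact hidx
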